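/- Let W be a suitable basis of A at {β₁,…,β_I}. Then every element f ∈ A can be decomposed as f = Δg + (1/ũ)·cW, where g ∈ A, c ∈ C[x]^r, ũ ∈ C[x] is nonzero, and the polynomial ũ·∏_{i=1}^I (x−β_i) ∈ C̄[x] is shift-free. -/

import Mathlib

set_option maxHeartbeats 1000000
set_option synthInstance.maxHeartbeats 200000

open Polynomial Filter

noncomputable section

namespace PRec

variable (C : Type*) [Field C] [CharZero C]

/-- The algebraic closure of the coefficient field. -/
abbrev Cbar := AlgebraicClosure C

/-- The field of formal Laurent series over the algebraic closure. -/
abbrev LS := LaurentSeries (Cbar C)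

/-- The Laurent-series variable `q`. -/
def qv : LS C := HahnSeries.single 1 1

open Classical in
/-- The valuation `ν_q`, with `ν_q 0 = ⊤`, valued in the extended reals. -/
def nuq (a : LS C) : EReal := if a = 0 then ⊤ else (((a.order : ℤ) : ℝ) : EReal)

/-- Evaluation of a rational function at the point `α + m + q`. -/
def evalAt (α : Cbar C) (m : ℤ) (p : RatFunc C) : LS C :=
  RatFunc.eval ((algebraMap (Cbar C) (LS C)).comp (algebraMap C (Cbar C)))
    (algebraMap (Cbar C) (LS C) α + (m : LS C) + qv C) p

/-- Shorthand for the canonical map `C[x] → C(x)`. -/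
abbrev toRat : Polynomial C →+* RatFunc C := algebraMap (Polynomial C) (RatFunc C)

variable (ℓ : ℕ → Polynomial C) (r : ℕ)

/-- The solution space `Sol_α(L)` of `L = ℓ₀ + ℓ₁ S + ⋯ + ℓ_r S^r` at `α`,
indexed so that `b n` stands for the value of the solution at `α + n`. -/
def SolSet (α : Cbar C) : Set (ℤ → LS C) :=
  {b | ∀ n : ℤ, ∑ i ∈ Finset.range (r + 1),
      evalAt C α n (toRat C (ℓ i)) * b (n + i) = 0}

/-- The action of an element `f = f₀ + f₁ S + ⋯ + f_{r-1} S^{r-1}` of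
`A = C(x)[S]/⟨L⟩` (represented by its coefficient vector) on a sequence. -/
def elemApply (α : Cbar C) (f : Fin r → RatFunc C) (b : ℤ → LS C) : ℤ → LS C :=
  fun n => ∑ i : Fin r, evalAt C α n (f i) * b (n + (i : ℤ))

/-- Truncated subtraction on extended reals with the convention `⊤ - ⊤ = ⊤`. -/
def esub (a b : EReal) : EReal := if b = ⊤ then ⊤ else a - b

/-- The value function `val_α` on `A`. -/
def valAt (α : Cbar C) (f : Fin r → RatFunc C) : EReal :=
  ⨅ b ∈ SolSet C ℓ r α,
    esub (nuq C (elemApply C r α f b 0))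
      (Filter.liminf (fun n : ℕ => nuq C (b (-(n : ℤ)))) Filter.atTop)

/-- `f ∈ A` is (locally) integral at `α`. -/
def IntegralAt (α : Cbar C) (f : Fin r → RatFunc C) : Prop :=
  0 ≤ valAt C ℓ r α f

/-- Membership in the local subring `C(x)_α` of rational functions having no pole at `α`. -/
def InLocalRing (α : Cbar C) (f : RatFunc C) : Prop :=
  ∃ p q : Polynomial C, (Polynomial.aeval α) q ≠ 0 ∧ f = toRat C p / toRat C q

/-- `W` is a `C(x)`-vector space basis of `A` (represented on coefficient vectors). -/
def IsVSBasis (W : Fin r → (Fin r → RatFunc C)) : Prop :=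
  LinearIndependent (RatFunc C) W ∧
    Submodule.span (RatFunc C) (Set.range W) = (⊤ : Submodule (RatFunc C) (Fin r → RatFunc C))

/-- The `C(x)_α`-span of a tuple of elements of `A`. -/
def localSpan (α : Cbar C) (W : Fin r → (Fin r → RatFunc C)) :
    Set (Fin r → RatFunc C) :=
  {f | ∃ c : Fin r → RatFunc C, (∀ i, InLocalRing C α (c i)) ∧ f = ∑ i, c i • W i}

/-- `W` is a local integral basis of `A` at `α`. -/
def IsLocalIntegralBasis (α : Cbar C) (W : Fin r → (Fin r → RatFunc C)) : Prop :=
  IsVSBasis C r W ∧ (∀ i, IntegralAt C ℓ r α (W i)) ∧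
    ∀ f : Fin r → RatFunc C, IntegralAt C ℓ r α f → f ∈ localSpan C r α W

/-- The standard basis `1, S, …, S^{r-1}` of `A`. -/
def stdBasis : Fin r → (Fin r → RatFunc C) :=
  fun i j => if j = i then 1 else 0

/-- The shift automorphism `p(x) ↦ p(x+c)` of the polynomial ring. -/
def polyShiftEquiv (c : C) : Polynomial C ≃+* Polynomial C where
  toFun p := p.comp (X + Polynomial.C c)
  invFun p := p.comp (X - Polynomial.C c)
  left_inv p := by
    show (p.comp (X + Polynomial.C c)).comp (X - Polynomial.C c) = p
    rw [Polynomial.comp_assoc]; simp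
  right_inv p := by
    show (p.comp (X - Polynomial.C c)).comp (X + Polynomial.C c) = p
    rw [Polynomial.comp_assoc]; simp
  map_add' p q := by simp [Polynomial.add_comp]
  map_mul' p q := by simp [Polynomial.mul_comp]

/-- The shift `σ^k`, `p(x) ↦ p(x+k)`, on polynomials, for `k : ℤ`. -/
def polyShift (k : ℤ) (p : Polynomial C) : Polynomial C := polyShiftEquiv C (k : C) p

/-- `σ` on polynomials. -/
def polyσ : Polynomial C ≃+* Polynomial C := polyShiftEquiv C 1

/-- The shift automorphism `σ : f(x) ↦ f(x+1)` of the rational function field. -/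
def ratσ : RatFunc C →+* RatFunc C :=
  RatFunc.mapRingHom (polyσ C : Polynomial C →+* Polynomial C)
    (by
      intro p hp
      simp only [Submonoid.mem_comap]
      refine mem_nonZeroDivisors_iff_ne_zero.mpr ?_
      have hp0 : p ≠ 0 := mem_nonZeroDivisors_iff_ne_zero.mp hp
      simpa using (map_ne_zero_iff _ (polyσ C).injective).mpr hp0)

variable [NeZero r]

/-- The index `r - 1` as an element of `Fin r`. -/
def lastIdx : Fin r := ⟨r - 1, Nat.sub_lt (Nat.pos_of_ne_zero (NeZero.ne r)) one_pos⟩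

/-- The action of `S` on `A = C(x)[S]/⟨L⟩`, on coefficient vectors with respect to the
basis `1, S, …, S^{r-1}`, using `S^r = -(ℓ₀/ℓ_r) - ⋯ - (ℓ_{r-1}/ℓ_r) S^{r-1}`. -/
def Smap (f : Fin r → RatFunc C) : Fin r → RatFunc C :=
  fun j =>
    (if (j : ℕ) = 0 then 0 else
      ratσ C (f ⟨(j : ℕ) - 1, lt_of_le_of_lt (Nat.sub_le _ _) j.isLt⟩))
      - ratσ C (f (lastIdx r)) * (toRat C (ℓ j) / toRat C (ℓ r))

/-- The difference operator `Δ = S - 1` on `A`. -/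
def Dmap (f : Fin r → RatFunc C) : Fin r → RatFunc C :=
  Smap C ℓ r f - f

/-- `f ∈ A` is summable. -/
def IsSummable (f : Fin r → RatFunc C) : Prop :=
  ∃ g : Fin r → RatFunc C, f = Dmap C ℓ r g

/-- `disp_α(p) ≥ k`: `p` has two roots in `α + ℤ` at distance `k`. -/
def DispGe (α : Cbar C) (p : Polynomial (Cbar C)) (k : ℕ) : Prop :=
  ∃ m : ℤ, Polynomial.eval (α + (m : Cbar C)) p = 0 ∧
    Polynomial.eval (α + (m : Cbar C) + (k : Cbar C)) p = 0

/-- The dispersion `disp_α(p)` as an extended natural number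
(`0` by convention for the empty set, which is excluded by the hypotheses below). -/
def dispVal (α : Cbar C) (p : Polynomial (Cbar C)) : ℕ∞ :=
  sSup ((fun k : ℕ => (k : ℕ∞)) '' {k : ℕ | DispGe C α p k})

/-- A polynomial is shift-free if it is coprime to each of its nontrivial shifts. -/
def ShiftFree {K : Type*} [Field K] [CharZero K] (p : Polynomial K) : Prop :=
  ∀ k : ℤ, k ≠ 0 → IsCoprime p (p.comp (X + Polynomial.C (k : K)))

/-- The data of the orbits `α_i + ℤ` of the roots of `ℓ₀ℓ_r`, with the minimal root
`minR i = α_{i,1}`, the maximal root `maxR i = α_{i,J_i}`, and the chosen bounds `β i`. -/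
structure SuitableData (I : ℕ) where
  β : Fin I → Cbar C
  minR : Fin I → Cbar C
  maxR : Fin I → Cbar C
  minR_root : ∀ i, (Polynomial.aeval (minR i)) (ℓ 0 * ℓ r) = 0
  maxR_root : ∀ i, (Polynomial.aeval (maxR i)) (ℓ 0 * ℓ r) = 0
  minR_le_maxR : ∀ i, ∃ m : ℕ, maxR i = minR i + (m : Cbar C)
  maxR_le_β : ∀ i, ∃ m : ℕ, β i = maxR i + (m : Cbar C)
  roots_between : ∀ i (m : ℤ), (Polynomial.aeval (minR i + (m : Cbar C))) (ℓ 0 * ℓ r) = 0 →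
    0 ≤ m ∧ ∃ k : ℕ, maxR i = minR i + (m : Cbar C) + (k : Cbar C)
  orbits_distinct : ∀ i i', i ≠ i' → ∀ m : ℤ, β i ≠ β i' + (m : Cbar C)
  orbits_cover : ∀ ξ : Cbar C, (Polynomial.aeval ξ) (ℓ 0 * ℓ r) = 0 →
    ∃ i, ∃ m : ℤ, ξ = β i + (m : Cbar C)
  conj_compat : ∀ (φ : Cbar C ≃ₐ[C] Cbar C) (i i' : Fin I), φ (maxR i) = maxR i' →
    β i - maxR i = β i' - maxR i'

/-- Membership in `Z = ⋃ᵢ {γ ∈ αᵢ + ℤ : α_{i,1} < γ ≤ βᵢ}`. -/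
def memZ {I : ℕ} (D : SuitableData C ℓ r I) (γ : Cbar C) : Prop :=
  ∃ i, (∃ m : ℕ, γ + (m : Cbar C) = D.β i) ∧ (∃ k : ℕ, 1 ≤ k ∧ γ = D.minR i + (k : Cbar C))

/-- `W` is a suitable basis of `A` at `{β₁, …, β_I}`. -/
def IsSuitableBasis {I : ℕ} (D : SuitableData C ℓ r I) (W : Fin r → (Fin r → RatFunc C)) :
    Prop :=
  IsVSBasis C r W ∧
    (∀ γ : Cbar C, memZ C ℓ r D γ → IsLocalIntegralBasis C ℓ r γ W) ∧
    (∀ γ : Cbar C, ¬ memZ C ℓ r D γ → localSpan C r γ W = localSpan C r γ (stdBasis C r))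

set_option linter.unusedSectionVars false

section Valuation

variable {C}

theorem nuq_zero : nuq C (0 : LS C) = ⊤ := by simp [nuq]

theorem nuq_of_ne {a : LS C} (h : a ≠ 0) : nuq C a = (((a.order : ℤ) : ℝ) : EReal) := by
  simp [nuq, h]

theorem nuq_ne_bot (a : LS C) : nuq C a ≠ ⊥ := by
  by_cases h : a = 0
  · simp [h, nuq_zero]
  · rw [nuq_of_ne h]; exact EReal.coe_ne_bot _

theorem nuq_mul (a b : LS C) : nuq C (a * b) = nuq C a + nuq C b := by
  by_cases ha : a = 0
  · simp [ha, nuq_zero, EReal.top_add_of_ne_bot (nuq_ne_bot b)]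
  by_cases hb : b = 0
  · simp [hb, nuq_zero, EReal.add_top_of_ne_bot (nuq_ne_bot a)]
  rw [nuq_of_ne (mul_ne_zero ha hb), nuq_of_ne ha, nuq_of_ne hb, HahnSeries.order_mul ha hb]
  push_cast
  rfl

theorem min_nuq_le_nuq_add (a b : LS C) : min (nuq C a) (nuq C b) ≤ nuq C (a + b) := by
  by_cases ha : a = 0
  · simp [ha]
  by_cases hb : b = 0
  · simp [hb]
  by_cases hab : a + b = 0
  · simp [hab, nuq_zero]
  have := HahnSeries.min_order_le_order_add hab
  rw [nuq_of_ne hab, nuq_of_ne ha, nuq_of_ne hb]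
  rcases min_le_iff.mp this with h | h
  · exact min_le_of_left_le (by exact_mod_cast h)
  · exact min_le_of_right_le (by exact_mod_cast h)

theorem nuq_neg (a : LS C) : nuq C (-a) = nuq C a := by
  by_cases ha : a = 0
  · simp [ha]
  · rw [nuq_of_ne ha, nuq_of_ne (neg_ne_zero.mpr ha), HahnSeries.order_neg]

theorem le_nuq_sum {ι : Type*} (s : Finset ι) (f : ι → LS C) {c : EReal}
    (h : ∀ i ∈ s, c ≤ nuq C (f i)) : c ≤ nuq C (∑ i ∈ s, f i) :=
  Finset.sum_induction f (fun a => c ≤ nuq C a)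
    (fun a b ha hb => (le_min ha hb).trans (min_nuq_le_nuq_add a b)) (by simp [nuq_zero]) h

theorem nuq_le_nuq_mul {a : LS C} (b : LS C) (ha : 0 ≤ nuq C a) : nuq C b ≤ nuq C (a * b) := by
  rw [nuq_mul]
  simpa using add_le_add_left ha (nuq C b)

theorem nuq_ofPowerSeries_nonneg (p : PowerSeries (Cbar C)) :
    0 ≤ nuq C (HahnSeries.ofPowerSeries ℤ (Cbar C) p) := by
  by_cases h : HahnSeries.ofPowerSeries ℤ (Cbar C) p = 0
  · simp [h, nuq_zero]
  rw [nuq_of_ne h]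
  have : 0 ≤ (HahnSeries.ofPowerSeries ℤ (Cbar C) p).order := by
    rw [HahnSeries.le_order_iff_forall h]
    intro j hj
    rw [PowerSeries.coeff_coe, if_pos hj]
  exact_mod_cast this

theorem nuq_ofPowerSeries_eq_zero_iff (p : PowerSeries (Cbar C)) :
    nuq C (HahnSeries.ofPowerSeries ℤ (Cbar C) p) = 0 ↔ PowerSeries.constantCoeff p ≠ 0 := by
  have hc : (HahnSeries.ofPowerSeries ℤ (Cbar C) p).coeff 0 = PowerSeries.constantCoeff p := by
    rw [PowerSeries.coeff_coe]; simp
  have h0 := nuq_ofPowerSeries_nonneg p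
  constructor
  · intro h hp
    by_cases hz : HahnSeries.ofPowerSeries ℤ (Cbar C) p = 0
    · simp [hz, nuq_zero] at h
    rw [nuq_of_ne hz] at h
    have h1 : (HahnSeries.ofPowerSeries ℤ (Cbar C) p).order = 0 := by exact_mod_cast h
    have h2 := (HahnSeries.coeff_order_eq_zero).not.mpr hz
    rw [h1, hc] at h2
    exact h2 hp
  · intro h
    rw [← hc] at h
    have hz : HahnSeries.ofPowerSeries ℤ (Cbar C) p ≠ 0 := by
      intro hz; simp [hz] at h
    have h1 := HahnSeries.order_le_of_coeff_ne_zero h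
    rw [nuq_of_ne hz] at h0 ⊢
    have h2 : 0 ≤ (HahnSeries.ofPowerSeries ℤ (Cbar C) p).order := by exact_mod_cast h0
    have h3 : (HahnSeries.ofPowerSeries ℤ (Cbar C) p).order = 0 := le_antisymm h1 h2
    simp [h3]

end Valuation

section Evaluation

variable {C}

/-- The Taylor expansion at `α + m`, as a ring homomorphism. -/
def taylorHom (α : Cbar C) (m : ℤ) : Polynomial C →+* PowerSeries (Cbar C) :=
  (Polynomial.coeToPowerSeries.ringHom).comp
    ((Polynomial.compRingHom (X + Polynomial.C (α + (m : Cbar C)))).comp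
      (Polynomial.mapRingHom (algebraMap C (Cbar C))))

theorem constantCoeff_taylorHom (α : Cbar C) (m : ℤ) (p : Polynomial C) :
    PowerSeries.constantCoeff (taylorHom α m p) = aeval (α + (m : Cbar C)) p := by
  simp [taylorHom, Polynomial.coeff_zero_eq_eval_zero, Polynomial.aeval_def,
    Polynomial.eval_map]

theorem taylorHom_ne_zero (α : Cbar C) (m : ℤ) {p : Polynomial C} (hp : p ≠ 0) :
    taylorHom α m p ≠ 0 := by
  simp only [taylorHom, RingHom.comp_apply, Polynomial.coeToPowerSeries.ringHom_apply, ne_eq,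
    Polynomial.coe_eq_zero_iff, Polynomial.coe_compRingHom, Polynomial.coe_mapRingHom]
  rw [Polynomial.comp_eq_zero_iff]
  rintro (h | ⟨_, h⟩)
  · exact hp ((Polynomial.map_eq_zero _).mp h)
  · have := congrArg (fun p => Polynomial.coeff p 1) h
    simp [Polynomial.coeff_C] at this

theorem eval₂_eq_taylorHom (α : Cbar C) (m : ℤ) (p : Polynomial C) :
    eval₂ ((algebraMap (Cbar C) (LS C)).comp (algebraMap C (Cbar C)))
      (algebraMap (Cbar C) (LS C) α + (m : LS C) + qv C) p =
      HahnSeries.ofPowerSeries ℤ (Cbar C) (taylorHom α m p) := by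
  have hC : ∀ a : Cbar C, algebraMap (Cbar C) (LS C) a = HahnSeries.C a := fun a => by
    rw [HahnSeries.algebraMap_apply']; simp
  have : (Polynomial.eval₂RingHom ((algebraMap (Cbar C) (LS C)).comp (algebraMap C (Cbar C)))
      (algebraMap (Cbar C) (LS C) α + (m : LS C) + qv C)) =
      (HahnSeries.ofPowerSeries ℤ (Cbar C)).comp (taylorHom α m) := by
    apply Polynomial.ringHom_ext
    · intro a
      simp [taylorHom, hC]
    · have hm : ((m : Polynomial (Cbar C)) : PowerSeries (Cbar C)) = (m : PowerSeries (Cbar C)) :=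
        map_intCast (Polynomial.coeToPowerSeries.ringHom (R := Cbar C)) m
      simp [taylorHom, hC, qv, hm]
      ring
  exact congrArg (fun φ => φ p) this

theorem eval₂_ne_zero (α : Cbar C) (m : ℤ) {p : Polynomial C} (hp : p ≠ 0) :
    eval₂ ((algebraMap (Cbar C) (LS C)).comp (algebraMap C (Cbar C)))
      (algebraMap (Cbar C) (LS C) α + (m : LS C) + qv C) p ≠ 0 := by
  rw [eval₂_eq_taylorHom]
  intro h
  exact taylorHom_ne_zero α m hp (HahnSeries.ofPowerSeries_injective (by rw [h, map_zero]))

theorem evalAt_toRat (α : Cbar C) (m : ℤ) (p : Polynomial C) :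
    evalAt C α m (toRat C p) = HahnSeries.ofPowerSeries ℤ (Cbar C) (taylorHom α m p) := by
  rw [evalAt, RatFunc.eval_algebraMap, ← eval₂_eq_taylorHom]; rfl

theorem evalAt_add (α : Cbar C) (m : ℤ) (f g : RatFunc C) :
    evalAt C α m (f + g) = evalAt C α m f + evalAt C α m g :=
  RatFunc.eval_add _ _ (eval₂_ne_zero α m f.denom_ne_zero) (eval₂_ne_zero α m g.denom_ne_zero)

theorem evalAt_mul (α : Cbar C) (m : ℤ) (f g : RatFunc C) :
    evalAt C α m (f * g) = evalAt C α m f * evalAt C α m g :=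
  RatFunc.eval_mul _ _ (eval₂_ne_zero α m f.denom_ne_zero) (eval₂_ne_zero α m g.denom_ne_zero)

theorem evalAt_zero (α : Cbar C) (m : ℤ) : evalAt C α m 0 = 0 := by
  rw [← map_zero (toRat C), evalAt_toRat]; simp

theorem evalAt_one (α : Cbar C) (m : ℤ) : evalAt C α m 1 = 1 := by
  rw [← map_one (toRat C), evalAt_toRat]; simp only [map_one]

/-- Evaluation at `α + m + q` as a ring homomorphism. -/
def evalHom (α : Cbar C) (m : ℤ) : RatFunc C →+* LS C where
  toFun := evalAt C α m
  map_one' := evalAt_one α m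
  map_zero' := evalAt_zero α m
  map_add' := evalAt_add α m
  map_mul' := evalAt_mul α m

theorem evalHom_apply (α : Cbar C) (m : ℤ) (f : RatFunc C) :
    evalHom α m f = evalAt C α m f := rfl

theorem nuq_evalAt_toRat_nonneg (α : Cbar C) (m : ℤ) (p : Polynomial C) :
    0 ≤ nuq C (evalAt C α m (toRat C p)) := by
  rw [evalAt_toRat]; exact nuq_ofPowerSeries_nonneg _

theorem nuq_evalAt_toRat_eq_zero_iff (α : Cbar C) (m : ℤ) (p : Polynomial C) :
    nuq C (evalAt C α m (toRat C p)) = 0 ↔ aeval (α + (m : Cbar C)) p ≠ 0 := by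
  rw [evalAt_toRat, nuq_ofPowerSeries_eq_zero_iff, constantCoeff_taylorHom]

theorem evalAt_add_one (α : Cbar C) (m : ℤ) (f : RatFunc C) :
    evalAt C (α + 1) m f = evalAt C α (m + 1) f := by
  simp only [evalAt, map_add, map_one, Int.cast_add, Int.cast_one]
  congr 1
  ring

theorem InLocalRing.nuq_nonneg {α : Cbar C} {f : RatFunc C} (h : InLocalRing C α f) :
    0 ≤ nuq C (evalAt C α 0 f) := by
  obtain ⟨p, q, hq, rfl⟩ := h
  have hq0 : q ≠ 0 := by rintro rfl; simp at hq
  have h1 : evalAt C α 0 (toRat C q) * evalAt C α 0 (toRat C p / toRat C q) =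
      evalAt C α 0 (toRat C p) := by
    rw [← evalAt_mul, mul_div_cancel₀]
    simpa using hq0
  have h2 := congrArg (nuq C) h1
  rw [nuq_mul, (nuq_evalAt_toRat_eq_zero_iff α 0 q).mpr (by simpa using hq), zero_add] at h2
  rw [h2]
  exact nuq_evalAt_toRat_nonneg _ _ _

theorem inLocalRing_of_nuq_nonneg {α : Cbar C} {f : RatFunc C}
    (h : 0 ≤ nuq C (evalAt C α 0 f)) : InLocalRing C α f := by
  refine ⟨f.num, f.denom, fun hd => ?_, (RatFunc.num_div_denom f).symm⟩
  have hn : aeval α f.num ≠ 0 := by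
    intro hn
    obtain ⟨a, b, hab⟩ := RatFunc.isCoprime_num_denom f
    have := congrArg (aeval α) hab
    simp [hn, hd] at this
  have h1 : evalAt C α 0 (toRat C f.denom) * evalAt C α 0 f =
      evalAt C α 0 (toRat C f.num) := by
    rw [← evalAt_mul]
    congr 1
    rw [mul_comm]
    refine (div_eq_iff ?_).mp (RatFunc.num_div_denom f) |>.symm
    simpa using f.denom_ne_zero
  have h2 := congrArg (nuq C) h1
  rw [nuq_mul, (nuq_evalAt_toRat_eq_zero_iff α 0 f.num).mpr (by simpa using hn)] at h2
  have h3 : nuq C (evalAt C α 0 (toRat C f.denom)) ≤ 0 := by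
    rw [← h2]
    simpa using add_le_add_right h (nuq C (evalAt C α 0 (toRat C f.denom)))
  have h4 := le_antisymm h3 (nuq_evalAt_toRat_nonneg α 0 f.denom)
  exact (nuq_evalAt_toRat_eq_zero_iff α 0 f.denom).mp h4 (by simpa using hd)

theorem InLocalRing.aeval_denom_ne_zero {α : Cbar C} {f : RatFunc C} (h : InLocalRing C α f) :
    aeval α f.denom ≠ 0 := by
  obtain ⟨p, q, hq, rfl⟩ := h
  have hq0 : q ≠ 0 := by rintro rfl; simp at hq
  obtain ⟨d, hd⟩ := RatFunc.denom_div_dvd p q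
  intro h0
  rw [hd, map_mul, h0, zero_mul] at hq
  exact hq rfl

variable (C) in
/-- The local ring `C(x)_α` as a subring of `C(x)`. -/
def localRing (α : Cbar C) : Subring (RatFunc C) where
  carrier := {f | InLocalRing C α f}
  mul_mem' := by
    rintro _ _ ⟨p, q, hq, rfl⟩ ⟨p', q', hq', rfl⟩
    refine ⟨p * p', q * q', by simp [hq, hq'], ?_⟩
    rw [map_mul, map_mul, div_mul_div_comm]
  one_mem' := ⟨1, 1, by simp, by simp⟩
  add_mem' := by
    rintro _ _ ⟨p, q, hq, rfl⟩ ⟨p', q', hq', rfl⟩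
    have h0 : toRat C q ≠ 0 := by
      rw [Ne, FaithfulSMul.algebraMap_eq_zero_iff]; rintro rfl; simp at hq
    have h0' : toRat C q' ≠ 0 := by
      rw [Ne, FaithfulSMul.algebraMap_eq_zero_iff]; rintro rfl; simp at hq'
    refine ⟨p * q' + q * p', q * q', by simp [hq, hq'], ?_⟩
    rw [map_add, map_mul, map_mul, map_mul, div_add_div _ _ h0 h0']
  zero_mem' := ⟨0, 1, by simp, by simp⟩
  neg_mem' := by
    rintro _ ⟨p, q, hq, rfl⟩
    exact ⟨-p, q, hq, by rw [map_neg, neg_div]⟩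

theorem mem_localRing {α : Cbar C} {f : RatFunc C} :
    f ∈ localRing C α ↔ InLocalRing C α f := Iff.rfl

end Evaluation

section Recurrence

/-- A sequence defined by a recursion of order `r` with prescribed initial values. -/
theorem exists_seq_of_recursion {K : Type*} (r : ℕ) (init : ℕ → K)
    (F : ℕ → (ℕ → K) → K) (hF : ∀ n x y, (∀ i < r, x i = y i) → F n x = F n y) :
    ∃ u : ℕ → K, (∀ i < r, u i = init i) ∧ ∀ n, u (n + r) = F n (fun i => u (n + i)) := by
  let st : ℕ → ℕ → K := fun n => Nat.rec init
    (fun n s i => if i + 1 < r then s (i + 1) else if i + 1 = r then F n s else s (i + 1)) n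
  have hst : ∀ n i, st (n + 1) i = if i + 1 = r then F n (st n) else st n (i + 1) := by
    intro n i
    show (if i + 1 < r then st n (i + 1) else if i + 1 = r then F n (st n) else st n (i + 1)) = _
    split_ifs <;> first | rfl | omega
  have hshift : ∀ i n, i < r → st n i = st (n + i) 0 := by
    intro i
    induction i with
    | zero => intro n _; rfl
    | succ i ih =>
      intro n hi
      have h1 := hst n i
      rw [if_neg (by omega)] at h1
      rw [← h1, ih (n + 1) (by omega), show n + 1 + i = n + (i + 1) by omega]
  rcases Nat.eq_zero_or_pos r with rfl | hr
  · exact ⟨fun n => F n init, by simp, fun n => by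
      simp only [add_zero]; exact hF _ _ _ (by simp)⟩
  refine ⟨fun n => st n 0, fun i hi => ?_, fun n => ?_⟩
  · have := hshift i 0 hi
    rw [zero_add] at this
    exact this.symm
  · have h1 := hst n (r - 1)
    rw [if_pos (by omega), hshift (r - 1) (n + 1) (by omega)] at h1
    show st (n + r) 0 = _
    rw [show n + r = n + 1 + (r - 1) by omega, h1]
    exact hF _ _ _ fun i hi => hshift i n hi

/-- A two-sided linear recurrence with nonvanishing extreme coefficients has a solution
with arbitrary prescribed values on a window. -/
theorem exists_int_solution {K : Type*} [Field K] (r : ℕ) (a : ℕ → ℤ → K)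
    (h0 : ∀ n, a 0 n ≠ 0) (hr : ∀ n, a r n ≠ 0) (hr1 : 1 ≤ r) (init : ℕ → K) :
    ∃ b : ℤ → K, (∀ i : ℕ, i < r → b i = init i) ∧
      ∀ n : ℤ, ∑ i ∈ Finset.range (r + 1), a i n * b (n + i) = 0 := by
  obtain ⟨u, hu, hu'⟩ := exists_seq_of_recursion r init
    (fun n x => -(a r n)⁻¹ * ∑ i ∈ Finset.range r, a i n * x i) (by
      intro n x y h
      congr 1
      exact Finset.sum_congr rfl fun i hi => by rw [h i (Finset.mem_range.mp hi)])
  obtain ⟨w, hw, hw'⟩ := exists_seq_of_recursion r (fun i => init (r - 1 - i))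
    (fun n x => -(a 0 (-1 - n))⁻¹ * ∑ i ∈ Finset.range r, a (i + 1) (-1 - n) * x (r - 1 - i)) (by
      intro n x y h
      congr 1
      exact Finset.sum_congr rfl fun i hi => by rw [h (r - 1 - i) (by omega)])
  let b : ℤ → K := fun n => if 0 ≤ n then u n.toNat else w (r - 1 - n).toNat
  have hbu : ∀ n : ℤ, ∀ k : ℕ, n = k → b n = u k := by
    rintro _ k rfl
    simp [b]
  have hbw : ∀ n : ℤ, ∀ k : ℕ, n = r - 1 - k → b n = w k := by
    rintro _ k rfl
    by_cases hk : k < r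
    · rw [hbu _ (r - 1 - k) (by omega), hu _ (by omega), hw _ hk]
    · simp only [b]
      rw [if_neg (by omega)]
      congr 1
      omega
  refine ⟨b, fun i hi => by rw [hbu i i rfl, hu i hi], fun n => ?_⟩
  rcases le_or_gt 0 n with hn | hn
  · obtain ⟨k, rfl⟩ := Int.eq_ofNat_of_zero_le hn
    rw [Finset.sum_range_succ, hbu (k + r) (k + r) (by simp), hu' k]
    rw [Finset.sum_congr rfl fun i _ => by rw [hbu (k + i) (k + i) (by simp)]]
    have := hr k
    field_simp
    ring
  · obtain ⟨k, hk⟩ := Int.eq_ofNat_of_zero_le (show 0 ≤ -1 - n by omega)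
    obtain rfl : n = -1 - k := by omega
    rw [Finset.sum_range_succ', hbw (-1 - k + ((0 : ℕ) : ℤ)) (k + r) (by push_cast; ring), hw' k]
    rw [Finset.sum_congr rfl fun i hi => by
      rw [hbw (-1 - k + ((i + 1 : ℕ) : ℤ)) (k + (r - 1 - i)) (by
        have := Finset.mem_range.mp hi; omega)]]
    have := h0 (-1 - k)
    field_simp
    ring

end Recurrence

section Integrality

variable {C} {ℓ r}

/-- The growth of a sequence to the left. -/
def leftGrowth (b : ℤ → LS C) : EReal :=
  Filter.liminf (fun n : ℕ => nuq C (b (-(n : ℤ)))) Filter.atTop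

theorem zero_le_esub_iff {a b : EReal} (ha : a ≠ ⊥) :
    0 ≤ esub a b ↔ b = ⊤ ∨ b ≤ a := by
  unfold esub
  split_ifs with h
  · simp [h]
  · rw [EReal.sub_nonneg (Or.inr h) (Or.inl ha)]
    simp [h]

theorem integralAt_iff {α : Cbar C} {f : Fin r → RatFunc C} :
    IntegralAt C ℓ r α f ↔ ∀ b ∈ SolSet C ℓ r α,
      leftGrowth b = ⊤ ∨ leftGrowth b ≤ nuq C (elemApply C r α f b 0) := by
  simp only [IntegralAt, valAt, le_iInf_iff]
  exact forall₂_congr fun b _ => zero_le_esub_iff (nuq_ne_bot _)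

theorem elemApply_sum_smul {ι : Type*} (s : Finset ι) (α : Cbar C) (c : ι → RatFunc C)
    (W : ι → Fin r → RatFunc C) (b : ℤ → LS C) :
    elemApply C r α (∑ i ∈ s, c i • W i) b 0 =
      ∑ i ∈ s, evalAt C α 0 (c i) * elemApply C r α (W i) b 0 := by
  simp only [elemApply, Finset.sum_apply, Pi.smul_apply, smul_eq_mul, ← evalHom_apply, map_sum,
    map_mul, Finset.mul_sum, Finset.sum_mul]
  rw [Finset.sum_comm]
  simp only [mul_assoc]

theorem IntegralAt.of_mem_localSpan {α : Cbar C} {W : Fin r → Fin r → RatFunc C}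
    (hW : ∀ i, IntegralAt C ℓ r α (W i)) {f : Fin r → RatFunc C}
    (hf : f ∈ localSpan C r α W) : IntegralAt C ℓ r α f := by
  obtain ⟨c, hc, rfl⟩ := hf
  rw [integralAt_iff]
  intro b hb
  by_cases ht : leftGrowth b = ⊤
  · exact Or.inl ht
  right
  rw [elemApply_sum_smul]
  refine le_nuq_sum _ _ fun i _ => ?_
  exact ((integralAt_iff.mp (hW i) b hb).resolve_left ht).trans
    (nuq_le_nuq_mul _ (hc i).nuq_nonneg)

theorem IsLocalIntegralBasis.mem_localSpan_iff {α : Cbar C} {W : Fin r → Fin r → RatFunc C}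
    (hW : IsLocalIntegralBasis C ℓ r α W) {f : Fin r → RatFunc C} :
    f ∈ localSpan C r α W ↔ IntegralAt C ℓ r α f :=
  ⟨IntegralAt.of_mem_localSpan hW.2.1, hW.2.2 f⟩

theorem mem_localSpan_stdBasis_iff {α : Cbar C} {f : Fin r → RatFunc C} :
    f ∈ localSpan C r α (stdBasis C r) ↔ ∀ i, InLocalRing C α (f i) := by
  have key : ∀ c : Fin r → RatFunc C, ∑ i, c i • stdBasis C r i = c := by
    intro c
    ext j
    simp [stdBasis, Finset.sum_apply]
  constructor
  · rintro ⟨c, hc, rfl⟩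
    rwa [key]
  · intro h
    exact ⟨f, h, (key f).symm⟩

/-- A lower bound on a window propagates one step to the right where `ℓ_r` is a unit. -/
theorem lt_nuq_right_step {α : Cbar C} {b : ℤ → LS C} (hb : b ∈ SolSet C ℓ r α) {c : EReal}
    {n : ℤ} (hn : aeval (α + (n : Cbar C)) (ℓ r) ≠ 0)
    (h : ∀ i : ℕ, i < r → c < nuq C (b (n + i))) (hc : c ≠ ⊤) : c < nuq C (b (n + r)) := by
  have h1 := hb n
  rw [Finset.sum_range_succ] at h1
  have h2 : nuq C (b (n + r)) =
      nuq C (∑ i ∈ Finset.range r, evalAt C α n (toRat C (ℓ i)) * b (n + i)) := by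
    rw [eq_neg_of_add_eq_zero_left h1, nuq_neg, nuq_mul,
      (nuq_evalAt_toRat_eq_zero_iff _ _ _).mpr hn, zero_add]
  rw [h2]
  refine Finset.sum_induction _ (fun a => c < nuq C a)
    (fun a b ha hb => (lt_min ha hb).trans_le (min_nuq_le_nuq_add a b))
    (by simpa [nuq_zero] using hc.lt_top) fun i hi => ?_
  exact (h i (Finset.mem_range.mp hi)).trans_le
    (nuq_le_nuq_mul _ (nuq_evalAt_toRat_nonneg _ _ _))

/-- A lower bound on a window propagates one step to the left where `ℓ₀` is a unit. -/
theorem le_nuq_left_step {α : Cbar C} {b : ℤ → LS C} (hb : b ∈ SolSet C ℓ r α) {c : EReal}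
    {n : ℤ} (hn : aeval (α + (n : Cbar C)) (ℓ 0) ≠ 0)
    (h : ∀ i : ℕ, i < r → c ≤ nuq C (b (n + 1 + i))) : c ≤ nuq C (b n) := by
  have h1 := hb n
  rw [Finset.sum_range_succ'] at h1
  have h2 : nuq C (b n) = nuq C (∑ i ∈ Finset.range r,
      evalAt C α n (toRat C (ℓ (i + 1))) * b (n + ((i + 1 : ℕ) : ℤ))) := by
    rw [eq_neg_of_add_eq_zero_left h1, nuq_neg, nuq_mul,
      (nuq_evalAt_toRat_eq_zero_iff _ _ _).mpr hn, zero_add]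
    simp
  rw [h2]
  refine le_nuq_sum _ _ fun i hi => ?_
  have h3 := h i (Finset.mem_range.mp hi)
  rw [show n + 1 + (i : ℤ) = n + ((i + 1 : ℕ) : ℤ) by push_cast; ring] at h3
  exact h3.trans (nuq_le_nuq_mul _ (nuq_evalAt_toRat_nonneg _ _ _))

theorem leftGrowth_le {α : Cbar C} {b : ℤ → LS C} (hb : b ∈ SolSet C ℓ r α)
    (hα : ∀ n : ℕ, 1 ≤ n → aeval (α - (n : Cbar C)) (ℓ r) ≠ 0) {j : ℕ} (hj : j < r) :
    leftGrowth b ≤ nuq C (b j) := by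
  by_contra! hlt
  obtain ⟨N, hN⟩ := Filter.eventually_atTop.mp (Filter.eventually_lt_of_lt_liminf hlt)
  have key : ∀ m : ℕ, ∀ i : ℤ, -(N + r : ℤ) ≤ i → i < -(N + r : ℤ) + r + m → i < r →
      nuq C (b j) < nuq C (b i) := by
    intro m
    induction m with
    | zero =>
      intro i hi hi' _
      have := hN (-i).toNat (by omega)
      rwa [show -((-i).toNat : ℤ) = i by omega] at this
    | succ m ih =>
      intro i hi hi' hir
      by_cases hm : i < -(N + r : ℤ) + r + m
      · exact ih i hi hm hir
      have := lt_nuq_right_step (c := nuq C (b j)) hb (n := i - r) (by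
          have := hα (-(i - r)).toNat (by omega)
          rwa [show α - ((-(i - r)).toNat : Cbar C) = α + ((i - r : ℤ) : Cbar C) by
            rw [sub_eq_add_neg, ← Int.cast_natCast, ← Int.cast_neg]
            congr 2
            omega] at this)
        (fun k hk => ih _ (by omega) (by omega) (by omega)) hlt.ne_top
      rwa [sub_add_cancel] at this
  exact lt_irrefl _ (key (N + r + j + 1) j (by omega) (by push_cast; omega) (by omega))

theorem le_leftGrowth {α : Cbar C} {b : ℤ → LS C} (hb : b ∈ SolSet C ℓ r α)
    (hα : ∀ n : ℕ, 1 ≤ n → aeval (α - (n : Cbar C)) (ℓ 0) ≠ 0) {c : EReal}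
    (hr : 1 ≤ r) (hc : ∀ j : ℕ, j < r → c ≤ nuq C (b j)) :
    c ≤ leftGrowth b := by
  have key : ∀ m : ℕ, ∀ i : ℤ, -(m : ℤ) ≤ i → i < r → c ≤ nuq C (b i) := by
    intro m
    induction m with
    | zero =>
      intro i hi hi'
      obtain ⟨k, rfl⟩ := Int.eq_ofNat_of_zero_le (show 0 ≤ i by omega)
      exact hc k (by omega)
    | succ m ih =>
      intro i hi hi'
      by_cases hm : -(m : ℤ) ≤ i
      · exact ih i hm hi'
      refine le_nuq_left_step hb ?_ fun k hk => ih _ (by omega) (by omega)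
      have := hα (-i).toNat (by omega)
      rwa [show α - ((-i).toNat : Cbar C) = α + (i : Cbar C) by
            rw [sub_eq_add_neg, ← Int.cast_natCast, ← Int.cast_neg]
            congr 2
            omega] at this
  refine Filter.le_liminf_of_le (by isBoundedDefault) (Filter.Eventually.of_forall fun n => ?_)
  exact key n _ le_rfl (by omega)

/-- To the left of all roots of `ℓ₀ ℓ_r`, the integral elements are those with regular
coordinates. -/
theorem integralAt_iff_mem_localSpan_stdBasis (hr : 1 ≤ r) (hℓ : ℓ 0 * ℓ r ≠ 0) {α : Cbar C}
    (hα : ∀ n : ℕ, 1 ≤ n → aeval (α - (n : Cbar C)) (ℓ 0 * ℓ r) ≠ 0) {f : Fin r → RatFunc C} :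
    IntegralAt C ℓ r α f ↔ f ∈ localSpan C r α (stdBasis C r) := by
  simp only [map_mul, mul_ne_zero_iff] at hα hℓ
  rw [mem_localSpan_stdBasis_iff]
  constructor
  · intro hf j
    obtain ⟨b, hb, hrec⟩ := exists_int_solution r (fun i n => evalAt C α n (toRat C (ℓ i)))
      (fun n => by
        rw [← evalHom_apply]; simpa using hℓ.1) (fun n => by
        rw [← evalHom_apply]; simpa using hℓ.2) hr (fun i => if i = j then 1 else 0)
    have h1 := integralAt_iff.mp hf b hrec
    have hone : nuq C (1 : LS C) = 0 := by rw [nuq_of_ne one_ne_zero]; simp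
    have h2 : leftGrowth b ≤ 0 := by
      refine (leftGrowth_le hrec (fun n hn => (hα n hn).2) j.isLt).trans_eq ?_
      rw [hb j j.isLt, if_pos rfl, hone]
    have h3 : 0 ≤ leftGrowth b := by
      refine le_leftGrowth hrec (fun n hn => (hα n hn).1) hr fun k hk => ?_
      rw [hb k hk]
      split_ifs
      · exact hone.ge
      · simp [nuq_zero]
    have h4 := h3.trans (h1.resolve_left (by
      intro h; rw [h] at h2; simp at h2))
    have h5 : elemApply C r α f b 0 = evalAt C α 0 (f j) := by
      unfold elemApply
      rw [Finset.sum_eq_single j]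
      · rw [zero_add, hb j j.isLt, if_pos rfl, mul_one]
      · intro i _ hij
        rw [zero_add, hb i i.isLt, if_neg (by simpa [Fin.ext_iff] using hij), mul_zero]
      · simp
    rw [h5] at h4
    exact inLocalRing_of_nuq_nonneg h4
  · intro hf
    rw [integralAt_iff]
    intro b hb
    right
    refine le_nuq_sum _ _ fun i _ => ?_
    rw [zero_add]
    exact (leftGrowth_le hb (fun n hn => (hα n hn).2) i.isLt).trans
      (nuq_le_nuq_mul _ (hf i).nuq_nonneg)

end Integrality

section Shift

variable {C} {ℓ r}

theorem aeval_polyσ (α : Cbar C) (p : Polynomial C) : aeval α (polyσ C p) = aeval (α + 1) p := by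
  simp [polyσ, polyShiftEquiv, Polynomial.aeval_comp]

theorem aeval_polyσ_symm (α : Cbar C) (p : Polynomial C) :
    aeval (α + 1) ((polyσ C).symm p) = aeval α p := by
  rw [← aeval_polyσ, RingEquiv.apply_symm_apply]

theorem ratσ_toRat (p : Polynomial C) : ratσ C (toRat C p) = toRat C (polyσ C p) := by
  rw [ratσ, RatFunc.coe_mapRingHom_eq_coe_map]
  have := RatFunc.map_apply_div (polyσ C : Polynomial C →+* Polynomial C) (by
    intro p hp
    simp only [Submonoid.mem_comap]
    refine mem_nonZeroDivisors_iff_ne_zero.mpr ?_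
    have hp0 : p ≠ 0 := mem_nonZeroDivisors_iff_ne_zero.mp hp
    simpa using (map_ne_zero_iff _ (polyσ C).injective).mpr hp0) p 1
  simpa using this

theorem ratσ_surjective : Function.Surjective (ratσ C) := by
  intro f
  induction f using RatFunc.induction_on with
  | f p q hq =>
    refine ⟨toRat C ((polyσ C).symm p) / toRat C ((polyσ C).symm q), ?_⟩
    rw [map_div₀, ratσ_toRat, ratσ_toRat, RingEquiv.apply_symm_apply, RingEquiv.apply_symm_apply]

theorem inLocalRing_ratσ_iff {α : Cbar C} {f : RatFunc C} :
    InLocalRing C α (ratσ C f) ↔ InLocalRing C (α + 1) f := by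
  constructor
  · rintro ⟨p, q, hq, h⟩
    refine ⟨(polyσ C).symm p, (polyσ C).symm q, by rwa [aeval_polyσ_symm],
      (ratσ C).injective ?_⟩
    rw [h, map_div₀, ratσ_toRat, ratσ_toRat, RingEquiv.apply_symm_apply,
      RingEquiv.apply_symm_apply]
  · rintro ⟨p, q, hq, rfl⟩
    refine ⟨polyσ C p, polyσ C q, by rwa [aeval_polyσ], ?_⟩
    rw [map_div₀, ratσ_toRat, ratσ_toRat]

theorem evalAt_toRat_polyσ (α : Cbar C) (m : ℤ) (p : Polynomial C) :
    evalAt C α m (toRat C (polyσ C p)) = evalAt C α (m + 1) (toRat C p) := by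
  rw [evalAt, evalAt, RatFunc.eval_algebraMap, RatFunc.eval_algebraMap]
  simp only [Algebra.algebraMap_self, RingHom.id_apply, polyσ, polyShiftEquiv, RingEquiv.coe_mk,
    Equiv.coe_fn_mk, Polynomial.eval₂_comp, eval₂_add, eval₂_X, eval₂_one, map_one, Int.cast_add,
    Int.cast_one]
  congr 1
  ring

theorem evalAt_ratσ (α : Cbar C) (m : ℤ) (f : RatFunc C) :
    evalAt C α m (ratσ C f) = evalAt C α (m + 1) f := by
  induction f using RatFunc.induction_on with
  | f p q hq =>
    rw [map_div₀, ratσ_toRat, ratσ_toRat]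
    simp only [← evalHom_apply, map_div₀]
    simp only [evalHom_apply, evalAt_toRat_polyσ]

theorem solSet_shift {α : Cbar C} {b : ℤ → LS C} :
    (fun n => b (n + 1)) ∈ SolSet C ℓ r (α + 1) ↔ b ∈ SolSet C ℓ r α := by
  simp only [SolSet, Set.mem_ofPred_eq, evalAt_add_one]
  constructor
  · intro h n
    have := h (n - 1)
    simp only [sub_add_cancel] at this
    rw [← this]
    exact Finset.sum_congr rfl fun i _ => by rw [show n - 1 + (i : ℤ) + 1 = n + i by ring]
  · intro h n
    rw [← h (n + 1)]
    exact Finset.sum_congr rfl fun i _ => by rw [show n + (i : ℤ) + 1 = n + 1 + i by ring]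

theorem leftGrowth_shift (b : ℤ → LS C) : leftGrowth (fun n => b (n + 1)) = leftGrowth b := by
  unfold leftGrowth
  rw [← Filter.liminf_nat_add (fun n : ℕ => nuq C (b (-(n : ℤ) + 1))) 1]
  congr 1
  ext n
  push_cast
  rw [show -((n : ℤ) + 1) + 1 = -n by ring]

theorem elemApply_Smap (hℓ : ℓ r ≠ 0) {α : Cbar C} {b : ℤ → LS C} (hb : b ∈ SolSet C ℓ r α)
    (f : Fin r → RatFunc C) :
    elemApply C r α (Smap C ℓ r f) b 0 = elemApply C r (α + 1) f (fun n => b (n + 1)) 0 := by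
  obtain ⟨s, rfl⟩ : ∃ s, r = s + 1 := ⟨r - 1, by have := NeZero.ne r; omega⟩
  have hlast : lastIdx (s + 1) = Fin.last s := rfl
  have h0 := hb 0
  rw [Finset.sum_range_succ, ← Fin.sum_univ_eq_sum_range
    (fun i => evalAt C α 0 (toRat C (ℓ i)) * b (0 + i))] at h0
  have hne : evalAt C α 0 (toRat C (ℓ (s + 1))) ≠ 0 := by
    rw [← evalHom_apply]; simpa using hℓ
  have h1 : ∑ i : Fin (s + 1), evalAt C α 0 (toRat C (ℓ i) / toRat C (ℓ (s + 1))) * b (0 + i) =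
      - b (0 + ((s + 1 : ℕ) : ℤ)) := by
    have : ∀ i : Fin (s + 1),
        evalAt C α 0 (toRat C (ℓ i) / toRat C (ℓ (s + 1))) * b (0 + i) =
        (evalAt C α 0 (toRat C (ℓ (s + 1))))⁻¹ * (evalAt C α 0 (toRat C (ℓ i)) * b (0 + i)) := by
      intro i
      simp only [← evalHom_apply, map_div₀]
      ring
    rw [Finset.sum_congr rfl fun i _ => this i, ← Finset.mul_sum, eq_neg_of_add_eq_zero_left h0]
    field_simp
  have h2 : elemApply C (s + 1) α (Smap C ℓ (s + 1) f) b 0 =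
      ∑ j : Fin (s + 1), evalAt C α 0 (if (j : ℕ) = 0 then 0 else
        ratσ C (f ⟨(j : ℕ) - 1, lt_of_le_of_lt (Nat.sub_le _ _) j.isLt⟩)) * b (0 + j)
      - evalAt C α 0 (ratσ C (f (lastIdx (s + 1)))) * ∑ i : Fin (s + 1),
        evalAt C α 0 (toRat C (ℓ i) / toRat C (ℓ (s + 1))) * b (0 + i) := by
    rw [Finset.mul_sum, ← Finset.sum_sub_distrib]
    refine Finset.sum_congr rfl fun j _ => ?_
    simp only [Smap, ← evalHom_apply, map_sub, map_mul]
    ring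
  rw [h2, h1, Fin.sum_univ_succ, elemApply, Fin.sum_univ_castSucc, hlast]
  simp only [Fin.val_zero, if_true, evalAt_zero, zero_mul, zero_add, Fin.val_succ,
    Nat.succ_ne_zero, if_false, evalAt_ratσ, evalAt_add_one, Fin.val_castSucc, Fin.val_last]
  rw [mul_neg, sub_neg_eq_add]
  congr 1

theorem integralAt_Smap_iff (hℓ : ℓ r ≠ 0) {α : Cbar C} {f : Fin r → RatFunc C} :
    IntegralAt C ℓ r α (Smap C ℓ r f) ↔ IntegralAt C ℓ r (α + 1) f := by
  rw [integralAt_iff, integralAt_iff]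
  constructor
  · intro h b hb
    have hb' : b = fun n => (fun n => b (n - 1)) (n + 1) := by simp
    rw [hb', solSet_shift (b := fun n => b (n - 1))] at hb
    have := h _ hb
    rwa [elemApply_Smap hℓ hb, ← leftGrowth_shift, ← hb'] at this
  · intro h b hb
    have := h _ (solSet_shift.mpr hb)
    rwa [← elemApply_Smap hℓ hb, leftGrowth_shift] at this

theorem Smap_add (f g : Fin r → RatFunc C) :
    Smap C ℓ r (f + g) = Smap C ℓ r f + Smap C ℓ r g := by
  ext j
  simp only [Smap, Pi.add_apply, map_add]
  split_ifs <;> ring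

theorem Smap_smul (a : RatFunc C) (f : Fin r → RatFunc C) :
    Smap C ℓ r (a • f) = ratσ C a • Smap C ℓ r f := by
  ext j
  simp only [Smap, Pi.smul_apply, smul_eq_mul, map_mul]
  split_ifs <;> ring

variable (ℓ r) in
/-- `S` as an additive homomorphism. -/
def SmapHom : (Fin r → RatFunc C) →+ (Fin r → RatFunc C) :=
  AddMonoidHom.mk' (Smap C ℓ r) Smap_add

theorem Smap_sum_smul {ι : Type*} (s : Finset ι) (c : ι → RatFunc C)
    (W : ι → Fin r → RatFunc C) :
    Smap C ℓ r (∑ i ∈ s, c i • W i) = ∑ i ∈ s, ratσ C (c i) • Smap C ℓ r (W i) := by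
  have := map_sum (SmapHom ℓ r) (fun i => c i • W i) s
  simp only [SmapHom, AddMonoidHom.mk'_apply] at this
  rw [this]
  exact Finset.sum_congr rfl fun i _ => Smap_smul _ _

theorem Smap_surjective (h0 : ℓ 0 ≠ 0) (hr : ℓ r ≠ 0) : Function.Surjective (Smap C ℓ r) := by
  intro h
  have h0' : toRat C (ℓ 0) ≠ 0 := by simpa using h0
  have hr' : toRat C (ℓ r) ≠ 0 := by simpa using hr
  obtain ⟨t, ht⟩ := ratσ_surjective (C := C)
    (-(h ⟨0, Nat.pos_of_ne_zero (NeZero.ne r)⟩) * (toRat C (ℓ r) / toRat C (ℓ 0)))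
  choose inv hinv using ratσ_surjective (C := C)
  refine ⟨fun j => if hj : (j : ℕ) + 1 < r then
    inv (h ⟨j + 1, hj⟩ + ratσ C t * (toRat C (ℓ (j + 1)) / toRat C (ℓ r))) else t, ?_⟩
  ext j
  have hpos := Nat.pos_of_ne_zero (NeZero.ne r)
  have hlast : ¬ ((lastIdx r : ℕ) + 1 < r) := by simp only [lastIdx]; omega
  simp only [Smap, dif_neg hlast]
  have hj := j.isLt
  by_cases hj0 : (j : ℕ) = 0
  · obtain rfl : j = ⟨0, hpos⟩ := Fin.ext hj0
    rw [if_pos rfl, ht]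
    field_simp
    ring
  · rw [if_neg hj0, dif_pos (show (j : ℕ) - 1 + 1 < r by omega), hinv]
    have h1 : (j : ℕ) - 1 + 1 = j := by omega
    simp only [h1]
    ring

end Shift

section Suitable

variable {C} {ℓ r}

theorem mem_localSpan_Smap_stdBasis_iff {γ : Cbar C} (h0 : aeval γ (ℓ 0) ≠ 0)
    (hr : aeval γ (ℓ r) ≠ 0) {v : Fin r → RatFunc C} :
    Smap C ℓ r v ∈ localSpan C r γ (stdBasis C r) ↔
      v ∈ localSpan C r (γ + 1) (stdBasis C r) := by
  have h0' : toRat C (ℓ 0) ≠ 0 := by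
    rw [Ne, FaithfulSMul.algebraMap_eq_zero_iff]; intro h; simp [h] at h0
  have hr' : toRat C (ℓ r) ≠ 0 := by
    rw [Ne, FaithfulSMul.algebraMap_eq_zero_iff]; intro h; simp [h] at hr
  rw [mem_localSpan_stdBasis_iff, mem_localSpan_stdBasis_iff]
  simp only [← inLocalRing_ratσ_iff (α := γ), ← mem_localRing]
  have hq : ∀ j, toRat C (ℓ j) / toRat C (ℓ r) ∈ localRing C γ := fun j => ⟨_, _, hr, rfl⟩
  have hpos := Nat.pos_of_ne_zero (NeZero.ne r)
  constructor
  · intro h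
    have hlast : ratσ C (v (lastIdx r)) ∈ localRing C γ := by
      have h1 := h ⟨0, hpos⟩
      simp only [Smap, if_true, zero_sub] at h1
      have h2 := mul_mem (neg_mem h1)
        (show toRat C (ℓ r) / toRat C (ℓ 0) ∈ localRing C γ from ⟨_, _, h0, rfl⟩)
      rw [neg_neg, mul_assoc, div_mul_div_cancel₀ hr', div_self h0', mul_one] at h2
      exact h2
    intro i
    by_cases hi : (i : ℕ) + 1 < r
    · have h1 := h ⟨i + 1, hi⟩
      simp only [Smap, Nat.succ_ne_zero, if_false, Nat.add_sub_cancel, Fin.eta] at h1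
      have h2 := add_mem h1 (mul_mem hlast (hq (i + 1)))
      rwa [sub_add_cancel] at h2
    · obtain rfl : i = lastIdx r := Fin.ext (by simp only [lastIdx]; omega)
      exact hlast
  · intro h j
    simp only [Smap]
    refine sub_mem ?_ (mul_mem (h _) (hq j))
    split_ifs
    · exact zero_mem _
    · exact h _

/-- The transition `S` between the local modules at `γ + 1` and `γ` is an isomorphism unless
`γ` is one of the points `β_i`. -/
theorem mem_localSpan_Smap_iff (hr : 1 ≤ r) (hℓ : ℓ 0 * ℓ r ≠ 0) {I : ℕ}
    (D : SuitableData C ℓ r I) {W : Fin r → (Fin r → RatFunc C)}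
    (hW : IsSuitableBasis C ℓ r D W) {γ : Cbar C} (hγ : ∀ i, γ ≠ D.β i)
    {v : Fin r → RatFunc C} :
    Smap C ℓ r v ∈ localSpan C r γ W ↔ v ∈ localSpan C r (γ + 1) W := by
  have hcast : Function.Injective (Int.cast : ℤ → Cbar C) := Int.cast_injective
  have hrne : ℓ r ≠ 0 := right_ne_zero_of_mul hℓ
  by_cases hcase : ∃ i, ∃ k n : ℕ, γ = D.minR i + k ∧ γ + n + 1 = D.β i
  · obtain ⟨i, k, n, hk, hn⟩ := hcase
    have hZ1 : memZ C ℓ r D (γ + 1) :=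
      ⟨i, ⟨n, by rw [← hn]; ring⟩, k + 1, by omega, by rw [hk]; push_cast; ring⟩
    rw [(hW.2.1 _ hZ1).mem_localSpan_iff, ← integralAt_Smap_iff hrne]
    rcases Nat.eq_zero_or_pos k with rfl | hk0
    · rw [Nat.cast_zero, add_zero] at hk
      have hnZ : ¬ memZ C ℓ r D γ := by
        rintro ⟨i', ⟨m, hm⟩, k', hk', hk''⟩
        by_cases hii : i = i'
        · subst hii
          rw [hk] at hk''
          have : (k' : Cbar C) = 0 := by linear_combination -hk''
          have : k' = 0 := by exact_mod_cast this
          omega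
        · refine D.orbits_distinct i i' hii ((n : ℤ) + 1 - m) ?_
          push_cast
          linear_combination hm - hn
      rw [hW.2.2 γ hnZ, integralAt_iff_mem_localSpan_stdBasis hr hℓ]
      intro m hm h
      have := (D.roots_between i (-m) (by push_cast; rwa [← hk, ← sub_eq_add_neg])).1
      omega
    · have hZ : memZ C ℓ r D γ :=
        ⟨i, ⟨n + 1, by rw [← hn]; push_cast; ring⟩, k, hk0, hk⟩
      rw [(hW.2.1 _ hZ).mem_localSpan_iff]
  · have hroot : aeval γ (ℓ 0 * ℓ r) ≠ 0 := by
      intro h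
      obtain ⟨i, m, hm⟩ := D.orbits_cover γ h
      obtain ⟨a, ha⟩ := D.minR_le_maxR i
      obtain ⟨b, hb⟩ := D.maxR_le_β i
      have h1 : γ = D.minR i + ((m + a + b : ℤ) : Cbar C) := by
        rw [hm, hb, ha]; push_cast; ring
      obtain ⟨hnn, k, hk⟩ := D.roots_between i (m + a + b) (by rwa [← h1])
      obtain ⟨e, he⟩ := Int.eq_ofNat_of_zero_le hnn
      rw [← h1] at hk
      rcases Nat.eq_zero_or_pos (k + b) with h0 | h0
      · apply hγ i
        rw [hb, hk, show k = 0 by omega, show b = 0 by omega]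
        simp
      · refine hcase ⟨i, e, k + b - 1, by rw [h1, he]; simp, ?_⟩
        rw [hb, hk, Nat.cast_sub (by omega)]
        push_cast
        ring
    have hZ : ¬ memZ C ℓ r D γ := by
      rintro ⟨i, ⟨m, hm⟩, k, hk, hk'⟩
      rcases Nat.eq_zero_or_pos m with rfl | h0
      · exact hγ i (by rw [← hm]; simp)
      · refine hcase ⟨i, k, m - 1, hk', ?_⟩
        rw [← hm, Nat.cast_sub (by omega)]
        push_cast
        ring
    have hZ1 : ¬ memZ C ℓ r D (γ + 1) := by
      rintro ⟨i, ⟨m, hm⟩, k, hk, hk'⟩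
      refine hcase ⟨i, k - 1, m, ?_, by rw [← hm]; ring⟩
      rw [Nat.cast_sub hk]
      push_cast
      linear_combination hk'
    rw [map_mul, mul_ne_zero_iff] at hroot
    rw [hW.2.2 _ hZ, hW.2.2 _ hZ1, mem_localSpan_Smap_stdBasis_iff hroot.1 hroot.2]

/-- The coordinates of elements which are regular outside `T` have a common denominator with
all roots in `T`. -/
theorem exists_common_denominator {W : Fin r → (Fin r → RatFunc C)} (hW : IsVSBasis C r W)
    (V : Fin r → (Fin r → RatFunc C)) (T : Set (Cbar C))
    (hV : ∀ γ ∉ T, ∀ i, V i ∈ localSpan C r γ W) :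
    ∃ b : Polynomial C, b ≠ 0 ∧ (∀ ξ : Cbar C, aeval ξ b = 0 → ξ ∈ T) ∧
      ∃ N : Fin r → Fin r → Polynomial C,
        ∀ i, toRat C b • V i = ∑ j, toRat C (N i j) • W j := by
  have hspan : ∀ v : Fin r → RatFunc C, ∃ c : Fin r → RatFunc C, ∑ i, c i • W i = v := fun v =>
    (Submodule.mem_span_range_iff_exists_fun (RatFunc C)).mp (hW.2 ▸ Submodule.mem_top)
  choose M hM using fun i => hspan (V i)
  have hreg : ∀ γ ∉ T, ∀ i j, InLocalRing C γ (M i j) := by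
    intro γ hγ i j
    obtain ⟨c, hc, hc'⟩ := hV γ hγ i
    have h0 : ∑ k, (M i k - c k) • W k = 0 := by
      simp only [sub_smul, Finset.sum_sub_distrib]
      rw [hM, ← hc', sub_self]
    have := Fintype.linearIndependent_iff.mp hW.1 _ h0 j
    rw [sub_eq_zero.mp this]
    exact hc j
  have hdvd : ∀ i j, (M i j).denom ∣ ∏ i, ∏ j, (M i j).denom := fun i j =>
    (Finset.dvd_prod_of_mem (fun j => (M i j).denom) (Finset.mem_univ j)).trans
      (Finset.dvd_prod_of_mem (fun i => ∏ j, (M i j).denom) (Finset.mem_univ i))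
  choose e he using hdvd
  refine ⟨∏ i, ∏ j, (M i j).denom, ?_, fun ξ hξ => ?_, fun i j => (M i j).num * e i j, fun i => ?_⟩
  · exact Finset.prod_ne_zero_iff.mpr fun i _ => Finset.prod_ne_zero_iff.mpr fun j _ =>
      (M i j).denom_ne_zero
  · simp only [map_prod, Finset.prod_eq_zero_iff, Finset.mem_univ, true_and] at hξ
    obtain ⟨i, j, hij⟩ := hξ
    by_contra hT
    exact (hreg ξ hT i j).aeval_denom_ne_zero hij
  · rw [← hM i, Finset.smul_sum]
    refine Finset.sum_congr rfl fun j _ => ?_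
    rw [smul_smul]
    congr 1
    have hd : toRat C (M i j).denom ≠ 0 := by simpa using (M i j).denom_ne_zero
    have h1 : M i j * toRat C (M i j).denom = toRat C (M i j).num :=
      ((div_eq_iff hd).mp (RatFunc.num_div_denom (M i j))).symm
    rw [he i j, map_mul, map_mul, ← h1]
    ring

/-- Polynomial denominators for the action of `S` on a suitable basis. -/
theorem exists_denominator_Smap (hr : 1 ≤ r) (hℓ : ℓ 0 * ℓ r ≠ 0) {I : ℕ}
    (D : SuitableData C ℓ r I) {W : Fin r → (Fin r → RatFunc C)}
    (hW : IsSuitableBasis C ℓ r D W) :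
    ∃ b : Polynomial C, b ≠ 0 ∧ (∀ ξ : Cbar C, aeval ξ b = 0 → ∃ i, ξ = D.β i) ∧
      ∀ c : Fin r → Polynomial C, ∃ c' : Fin r → Polynomial C,
        toRat C b • Smap C ℓ r (∑ i, toRat C (c i) • W i) = ∑ i, toRat C (c' i) • W i := by
  obtain ⟨b, hb, hbT, N, hN⟩ := exists_common_denominator hW.1 (fun i => Smap C ℓ r (W i))
    {γ | ∃ i, γ = D.β i} (by
      intro γ hγ i
      rw [mem_localSpan_Smap_iff hr hℓ D hW fun j hj => hγ ⟨j, hj⟩]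
      refine ⟨Pi.single i 1, fun j => ?_, by simp [Pi.single_apply]⟩
      rw [← mem_localRing]
      by_cases hj : j = i
      · subst hj; simp
      · simp [hj])
  refine ⟨b, hb, hbT, fun c => ⟨fun j => ∑ i, polyσ C (c i) * N i j, ?_⟩⟩
  rw [Smap_sum_smul, Finset.smul_sum]
  simp only [map_sum, Finset.sum_smul]
  rw [Finset.sum_comm]
  refine Finset.sum_congr rfl fun i _ => ?_
  rw [smul_comm, hN, Finset.smul_sum, ratσ_toRat]
  simp only [smul_smul, map_mul]

/-- Polynomial denominators for the action of `S⁻¹` on a suitable basis. -/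
theorem exists_denominator_Smap_symm (hr : 1 ≤ r) (hℓ : ℓ 0 * ℓ r ≠ 0) {I : ℕ}
    (D : SuitableData C ℓ r I) {W : Fin r → (Fin r → RatFunc C)}
    (hW : IsSuitableBasis C ℓ r D W) :
    ∃ b : Polynomial C, b ≠ 0 ∧ (∀ ξ : Cbar C, aeval ξ b = 0 → ∃ i, ξ = D.β i) ∧
      ∀ c : Fin r → Polynomial C, ∃ c' : Fin r → Polynomial C,
        toRat C b • ∑ i, toRat C (c i) • W i = Smap C ℓ r (∑ i, toRat C (c' i) • W i) := by
  choose V hV using fun i => Smap_surjective (ℓ := ℓ) (r := r) (left_ne_zero_of_mul hℓ)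
    (right_ne_zero_of_mul hℓ) (W i)
  obtain ⟨b, hb, hbT, N, hN⟩ := exists_common_denominator hW.1 V
    {γ | ∃ i, γ = D.β i + 1} (by
      intro γ hγ i
      have h := mem_localSpan_Smap_iff hr hℓ D hW (γ := γ - 1) (v := V i)
        fun j hj => hγ ⟨j, by rw [← hj]; ring⟩
      rw [sub_add_cancel] at h
      rw [← h, hV]
      refine ⟨Pi.single i 1, fun j => ?_, by simp [Pi.single_apply]⟩
      rw [← mem_localRing]
      by_cases hj : j = i
      · subst hj; simp
      · simp [hj])
  refine ⟨polyσ C b, by simpa using hb, fun ξ hξ => ?_, fun c =>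
    ⟨fun j => ∑ i, (polyσ C).symm (c i) * N i j, ?_⟩⟩
  · rw [aeval_polyσ] at hξ
    obtain ⟨i, hi⟩ := hbT _ hξ
    exact ⟨i, add_right_cancel hi⟩
  · have h1 : ∑ j, toRat C (∑ i, (polyσ C).symm (c i) * N i j) • W j =
        ∑ i, (toRat C ((polyσ C).symm (c i)) * toRat C b) • V i := by
      simp only [map_sum, Finset.sum_smul]
      rw [Finset.sum_comm]
      refine Finset.sum_congr rfl fun i _ => ?_
      rw [mul_smul, hN, Finset.smul_sum]
      simp only [smul_smul, map_mul]
    rw [h1, Smap_sum_smul, Finset.smul_sum]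
    refine Finset.sum_congr rfl fun i _ => ?_
    rw [hV, map_mul, ratσ_toRat, ratσ_toRat, RingEquiv.apply_symm_apply, smul_smul, mul_comm]

end Suitable

section PolyShift

variable {C}

theorem aeval_polyShift (α : Cbar C) (k : ℤ) (p : Polynomial C) :
    aeval α (polyShift C k p) = aeval (α + k) p := by
  simp [polyShift, polyShiftEquiv, Polynomial.aeval_comp]

theorem polyShift_pow (k : ℤ) (p : Polynomial C) (m : ℕ) :
    polyShift C k (p ^ m) = polyShift C k p ^ m := map_pow _ _ _

theorem polyShift_zero (p : Polynomial C) : polyShift C 0 p = p := by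
  simp [polyShift, polyShiftEquiv]

theorem polyσ_polyShift (k : ℤ) (p : Polynomial C) :
    polyσ C (polyShift C k p) = polyShift C (k + 1) p := by
  simp only [polyσ, polyShift, polyShiftEquiv, RingEquiv.coe_mk, Equiv.coe_fn_mk,
    Polynomial.comp_assoc]
  congr 1
  simp
  ring

theorem polyσ_symm_polyShift (k : ℤ) (p : Polynomial C) :
    (polyσ C).symm (polyShift C k p) = polyShift C (k - 1) p := by
  rw [RingEquiv.symm_apply_eq, polyσ_polyShift, sub_add_cancel]

theorem polyShift_ne_zero {k : ℤ} {p : Polynomial C} (hp : p ≠ 0) : polyShift C k p ≠ 0 := by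
  simpa [polyShift] using hp

theorem irreducible_polyShift {k : ℤ} {p : Polynomial C} (hp : Irreducible p) :
    Irreducible (polyShift C k p) :=
  (MulEquiv.irreducible_iff (polyShiftEquiv C (k : C))).mpr hp

theorem dvd_of_common_root {q d : Polynomial C} (hq : Irreducible q) {ξ : Cbar C}
    (h : aeval ξ q = 0) (h' : aeval ξ d = 0) : q ∣ d := by
  by_contra hd
  rcases (Polynomial.isCoprime_iff_aeval_ne_zero_of_isAlgClosed C (Cbar C) q d).mp
    (hq.coprime_iff_not_dvd.mpr hd) ξ with h1 | h1
  · exact h1 h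
  · exact h1 h'

theorem exists_algEquiv_of_roots {q : Polynomial C} (hq : Irreducible q) {ξ η : Cbar C}
    (h : aeval ξ q = 0) (h' : aeval η q = 0) : ∃ φ : Cbar C ≃ₐ[C] Cbar C, φ ξ = η := by
  refine isConjRoot_iff_exists_algEquiv.mp ?_
  rw [isConjRoot_def, ← minpoly.eq_of_irreducible hq h, ← minpoly.eq_of_irreducible hq h']

theorem eq_zero_of_roots_of_irreducible {q : Polynomial C} (hq : Irreducible q) {ξ : Cbar C}
    {k : ℤ} (h : aeval ξ q = 0) (h' : aeval (ξ + k) q = 0) : k = 0 := by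
  by_contra hk
  obtain ⟨φ, hφ⟩ := exists_algEquiv_of_roots hq h h'
  have key : ∀ n : ℕ, aeval (ξ + ((n * k : ℤ) : Cbar C)) q = 0 := by
    intro n
    induction n with
    | zero => simpa using h
    | succ n ih =>
      have h1 := congrArg φ ih
      rw [map_zero, ← Polynomial.aeval_algHom_apply, map_add, hφ, map_intCast] at h1
      rw [← h1]
      congr 2
      push_cast
      ring
  refine Set.infinite_of_injective_forall_mem (f := fun n : ℕ => ξ + ((n * k : ℤ) : Cbar C))
    (s := q.rootSet (Cbar C)) (fun a b hab => ?_) (fun n => ?_) (q.rootSet_finite (Cbar C))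
  · have h1 := Int.cast_injective (add_left_cancel hab)
    have h2 := mul_right_cancel₀ hk h1
    exact_mod_cast h2
  · exact (Polynomial.mem_rootSet_of_ne hq.ne_zero).mpr (key n)

end PolyShift

section Reduction

variable {C} {ℓ r}

variable (ℓ) in
/-- Elements with denominator `u` with respect to `W` are equivalent modulo summable elements
to elements with denominator `u'`. -/
def Reduces (W : Fin r → (Fin r → RatFunc C)) (u u' : Polynomial C) : Prop :=
  ∀ c : Fin r → Polynomial C, ∃ (g : Fin r → RatFunc C) (c' : Fin r → Polynomial C),
    (toRat C u)⁻¹ • ∑ i, toRat C (c i) • W i =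
      Dmap C ℓ r g + (toRat C u')⁻¹ • ∑ i, toRat C (c' i) • W i

variable {W : Fin r → (Fin r → RatFunc C)}

theorem Smap_zero : Smap C ℓ r 0 = 0 := map_zero (SmapHom ℓ r)

theorem Dmap_zero : Dmap C ℓ r 0 = 0 := by rw [Dmap, Smap_zero, sub_zero]

theorem Dmap_add (g h : Fin r → RatFunc C) :
    Dmap C ℓ r (g + h) = Dmap C ℓ r g + Dmap C ℓ r h := by
  rw [Dmap, Smap_add, Dmap, Dmap]; abel

theorem Dmap_neg (g : Fin r → RatFunc C) : Dmap C ℓ r (-g) = -Dmap C ℓ r g := by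
  rw [eq_neg_iff_add_eq_zero, ← Dmap_add, neg_add_cancel, Dmap_zero]

theorem toRat_smul_combination (W : Fin r → (Fin r → RatFunc C)) (p : Polynomial C)
    (c : Fin r → Polynomial C) :
    toRat C p • ∑ i, toRat C (c i) • W i = ∑ i, toRat C (p * c i) • W i := by
  simp only [Finset.smul_sum, smul_smul, map_mul]

theorem combination_add (W : Fin r → (Fin r → RatFunc C)) (c d : Fin r → Polynomial C) :
    ∑ i, toRat C (c i) • W i + ∑ i, toRat C (d i) • W i = ∑ i, toRat C (c i + d i) • W i := by
  simp only [← Finset.sum_add_distrib, ← add_smul, map_add]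

theorem Reduces.refl (u : Polynomial C) : Reduces ℓ W u u := fun c =>
  ⟨0, c, by rw [Dmap_zero, zero_add]⟩

theorem Reduces.trans {u v w : Polynomial C} (h : Reduces ℓ W u v) (h' : Reduces ℓ W v w) :
    Reduces ℓ W u w := by
  intro c
  obtain ⟨g, d, h1⟩ := h c
  obtain ⟨g', e, h2⟩ := h' d
  exact ⟨g + g', e, by rw [h1, h2, Dmap_add, add_assoc]⟩

theorem Reduces.mul {x y x' y' : Polynomial C} (hxy : IsCoprime x y) (hx0 : x ≠ 0) (hy0 : y ≠ 0)
    (hx0' : x' ≠ 0) (hy0' : y' ≠ 0) (hx : Reduces ℓ W x x') (hy : Reduces ℓ W y y') :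
    Reduces ℓ W (x * y) (x' * y') := by
  intro c
  obtain ⟨a, b, hab⟩ := hxy
  obtain ⟨g, d, h1⟩ := hx fun i => b * c i
  obtain ⟨g', e, h2⟩ := hy fun i => a * c i
  refine ⟨g + g', fun i => y' * d i + x' * e i, ?_⟩
  have hab' := congrArg (toRat C) hab
  rw [map_add, map_mul, map_mul, map_one] at hab'
  have hx0 : toRat C x ≠ 0 := by simpa using hx0
  have hy0 : toRat C y ≠ 0 := by simpa using hy0
  have hx0' : toRat C x' ≠ 0 := by simpa using hx0'
  have hy0' : toRat C y' ≠ 0 := by simpa using hy0'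
  have h3 : (toRat C (x * y))⁻¹ • ∑ i, toRat C (c i) • W i =
      (toRat C x)⁻¹ • ∑ i, toRat C (b * c i) • W i +
        (toRat C y)⁻¹ • ∑ i, toRat C (a * c i) • W i := by
    rw [← toRat_smul_combination, ← toRat_smul_combination, smul_smul, smul_smul, ← add_smul]
    congr 1
    rw [map_mul]
    field_simp
    linear_combination -hab'
  rw [h3, h1, h2, Dmap_add, ← combination_add, ← toRat_smul_combination,
    ← toRat_smul_combination, smul_add, smul_smul, smul_smul, map_mul,
    show (toRat C x' * toRat C y')⁻¹ * toRat C y' = (toRat C x')⁻¹ by field_simp,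
    show (toRat C x' * toRat C y')⁻¹ * toRat C x' = (toRat C y')⁻¹ by field_simp]
  abel

/-- Applying `S` moves a denominator one step to the left. -/
theorem reduces_left {b : Polynomial C} (hb0 : b ≠ 0)
    (hb : ∀ c : Fin r → Polynomial C, ∃ c' : Fin r → Polynomial C,
      toRat C b • Smap C ℓ r (∑ i, toRat C (c i) • W i) = ∑ i, toRat C (c' i) • W i)
    (u : Polynomial C) : Reduces ℓ W u (polyσ C u * b) := by
  intro c
  obtain ⟨c', hc'⟩ := hb c
  refine ⟨-((toRat C u)⁻¹ • ∑ i, toRat C (c i) • W i), c', ?_⟩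
  have hb0 : toRat C b ≠ 0 := by simpa using hb0
  rw [← hc', Dmap_neg, Dmap, Smap_smul, map_inv₀, ratσ_toRat, smul_smul, map_mul, mul_inv,
    inv_mul_cancel_right₀ hb0]
  abel

/-- Applying `S⁻¹` moves a denominator one step to the right. -/
theorem reduces_right {b : Polynomial C}
    (hb : ∀ c : Fin r → Polynomial C, ∃ c' : Fin r → Polynomial C,
      toRat C b • ∑ i, toRat C (c i) • W i = Smap C ℓ r (∑ i, toRat C (c' i) • W i))
    {u : Polynomial C} (hu0 : u ≠ 0) (hu : IsCoprime u b) :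
    Reduces ℓ W u ((polyσ C).symm u) := by
  intro c
  obtain ⟨s, t, hst⟩ := hu
  obtain ⟨c', hc'⟩ := hb fun i => t * c i
  have hst' := congrArg (toRat C) hst
  rw [map_add, map_mul, map_mul, map_one] at hst'
  have hv0 : toRat C ((polyσ C).symm u) ≠ 0 := by simpa using hu0
  have hu0 : toRat C u ≠ 0 := by simpa using hu0
  refine ⟨(toRat C ((polyσ C).symm u))⁻¹ • ∑ i, toRat C (c' i) • W i,
    fun i => c' i + (polyσ C).symm u * (s * c i), ?_⟩
  rw [Dmap, Smap_smul, map_inv₀, ratσ_toRat, RingEquiv.apply_symm_apply, ← hc',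
    ← combination_add, smul_add, ← toRat_smul_combination, ← toRat_smul_combination,
    ← toRat_smul_combination, inv_smul_smul₀ hv0]
  have h1 : (toRat C u)⁻¹ = (toRat C u)⁻¹ * (toRat C b * toRat C t) + toRat C s := by
    field_simp
    linear_combination -hst'
  conv_lhs => rw [h1, add_smul, mul_smul, mul_smul]
  abel

theorem exists_reduces_left_iterate {b : Polynomial C} (hb0 : b ≠ 0)
    (hb : ∀ c : Fin r → Polynomial C, ∃ c' : Fin r → Polynomial C,
      toRat C b • Smap C ℓ r (∑ i, toRat C (c i) • W i) = ∑ i, toRat C (c' i) • W i)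
    {u : Polynomial C} (hu0 : u ≠ 0) (k : ℕ)
    (hk : ∀ j : ℕ, 0 < j → j < k → IsCoprime (polyShift C j u) b) :
    ∃ N : ℕ, Reduces ℓ W u (polyShift C k u * b ^ N) := by
  induction k with
  | zero => exact ⟨0, by simpa [polyShift_zero] using Reduces.refl u⟩
  | succ k ih =>
    rcases Nat.eq_zero_or_pos k with rfl | hk0
    · refine ⟨1, ?_⟩
      have h1 := reduces_left hb0 hb u
      rw [← polyShift_zero u, polyσ_polyShift, polyShift_zero] at h1
      simpa using h1
    · obtain ⟨N, hN⟩ := ih fun j h0 hj => hk j h0 (by omega)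
      refine ⟨1 + N, hN.trans ?_⟩
      rw [pow_add, pow_one, ← mul_assoc]
      have h1 := reduces_left hb0 hb (polyShift C k u)
      rw [polyσ_polyShift] at h1
      exact Reduces.mul ((hk k hk0 (by omega)).pow_right) (polyShift_ne_zero hu0)
        (pow_ne_zero _ hb0) (mul_ne_zero (polyShift_ne_zero hu0) hb0) (pow_ne_zero _ hb0)
        (by exact_mod_cast h1) (Reduces.refl _)

theorem reduces_right_iterate {b : Polynomial C}
    (hb : ∀ c : Fin r → Polynomial C, ∃ c' : Fin r → Polynomial C,
      toRat C b • ∑ i, toRat C (c i) • W i = Smap C ℓ r (∑ i, toRat C (c' i) • W i))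
    {u : Polynomial C} (hu0 : u ≠ 0) (k : ℕ)
    (hk : ∀ j : ℕ, j < k → IsCoprime (polyShift C (-j) u) b) :
    Reduces ℓ W u (polyShift C (-k) u) := by
  induction k with
  | zero => simpa [polyShift_zero] using Reduces.refl u
  | succ k ih =>
    have h1 := reduces_right hb (polyShift_ne_zero hu0) (hk k (by omega))
    rw [polyσ_symm_polyShift] at h1
    refine (ih fun j hj => hk j (by omega)).trans ?_
    rwa [show (-((k + 1 : ℕ) : ℤ)) = -k - 1 by push_cast; ring]

end Reduction

section ShiftFreeDenominators

variable {C} {ℓ r} {I : ℕ} {D : SuitableData C ℓ r I} {W : Fin r → (Fin r → RatFunc C)}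

variable (D) in
/-- `ξ` is a root of `u` or one of the points `β_i`. -/
def IsRootOrBase (u : Polynomial C) (ξ : Cbar C) : Prop := aeval ξ u = 0 ∨ ∃ i, ξ = D.β i

variable (D) in
/-- No two roots of `u · ∏ (x - β_i)` differ by a nonzero integer. -/
def RootsShiftFree (u : Polynomial C) : Prop :=
  ∀ (ξ : Cbar C) (k : ℤ), IsRootOrBase D u ξ → IsRootOrBase D u (ξ + k) → k = 0

theorem RootsShiftFree.mono {u v : Polynomial C} (hu : RootsShiftFree D u)
    (h : ∀ ξ : Cbar C, aeval ξ v = 0 → IsRootOrBase D u ξ) : RootsShiftFree D v :=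
  fun ξ k h1 h2 => hu ξ k (h1.elim (h ξ) Or.inr) (h2.elim (h _) Or.inr)

theorem rootsShiftFree_one : RootsShiftFree D 1 := by
  rintro ξ k (h | ⟨i, rfl⟩) (h' | ⟨i', hi'⟩)
  · simp at h
  · simp at h
  · simp at h'
  · by_cases hii : i' = i
    · subst hii
      simpa using hi'
    · exact absurd hi'.symm (D.orbits_distinct i' i hii k)

/-- The set of the points `β_i` is stable under conjugation. -/
theorem exists_algEquiv_β_eq (φ : Cbar C ≃ₐ[C] Cbar C) (i : Fin I) :
    ∃ i', φ (D.β i) = D.β i' := by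
  have hφ : ∀ (ψ : Cbar C ≃ₐ[C] Cbar C) (ξ : Cbar C), aeval ξ (ℓ 0 * ℓ r) = 0 →
      aeval (ψ ξ) (ℓ 0 * ℓ r) = 0 := fun ψ ξ h => by
    rw [Polynomial.aeval_algHom_apply, h, map_zero]
  obtain ⟨m, hm⟩ := D.maxR_le_β i
  obtain ⟨a, ha⟩ := D.minR_le_maxR i
  have h1 := hφ φ _ (D.maxR_root i)
  obtain ⟨i', n, hn⟩ := D.orbits_cover _ h1
  obtain ⟨m', hm'⟩ := D.maxR_le_β i'
  obtain ⟨a', ha'⟩ := D.minR_le_maxR i'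
  have h2 : φ (D.maxR i) = D.minR i' + ((n + m' + a' : ℤ) : Cbar C) := by
    rw [hn, hm', ha']; push_cast; ring
  obtain ⟨-, k, hk⟩ := D.roots_between i' _ (h2 ▸ h1)
  rw [← h2] at hk
  have h3 := hφ φ.symm _ (D.maxR_root i')
  have h4 : φ.symm (D.maxR i') = D.minR i + ((a + k : ℤ) : Cbar C) := by
    rw [hk, map_add, φ.symm_apply_apply, map_natCast, ha]; push_cast; ring
  obtain ⟨-, k', hk'⟩ := D.roots_between i _ (h4 ▸ h3)
  have hk0 : ((k + k' : ℕ) : Cbar C) = 0 := by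
    push_cast at hk' ⊢
    linear_combination ha - hk'
  have hk0 : k = 0 := by
    have : k + k' = 0 := by exact_mod_cast hk0
    omega
  subst hk0
  have h5 : φ (D.maxR i) = D.maxR i' := by simpa using hk.symm
  have h6 := D.conj_compat φ i i' h5
  refine ⟨i', ?_⟩
  rw [hm, map_add, map_natCast, h5]
  linear_combination h6 - hm

theorem IsRootOrBase.of_irreducible {u q : Polynomial C} (hq : Irreducible q) {ξ η : Cbar C}
    (hξ : aeval ξ q = 0) (hη : aeval η q = 0) (h : IsRootOrBase D u ξ) : IsRootOrBase D u η := by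
  rcases h with h | ⟨i, rfl⟩
  · obtain ⟨d, rfl⟩ := dvd_of_common_root hq hξ h
    exact Or.inl (by rw [map_mul, hη, zero_mul])
  · obtain ⟨φ, rfl⟩ := exists_algEquiv_of_roots hq hξ hη
    exact Or.inr (exists_algEquiv_β_eq φ i)

theorem exists_reduces_of_irreducible (hr : 1 ≤ r) (hℓ : ℓ 0 * ℓ r ≠ 0)
    (hW : IsSuitableBasis C ℓ r D W) {p : Polynomial C} (hp : Irreducible p) (m : ℕ)
    {u : Polynomial C} (hu : RootsShiftFree D u) :
    ∃ u' : Polynomial C, u' ≠ 0 ∧ RootsShiftFree D (u * u') ∧ Reduces ℓ W (p ^ m) u' := by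
  have hpm : p ^ m ≠ 0 := pow_ne_zero _ hp.ne_zero
  by_cases hk : ∃ (k : ℤ) (ξ : Cbar C), aeval ξ (polyShift C k p) = 0 ∧ IsRootOrBase D u ξ
  · obtain ⟨k, ξ, hξ, hξu⟩ := hk
    have hroot : ∀ η : Cbar C, aeval η (polyShift C k p) = 0 → IsRootOrBase D u η := fun η hη =>
      hξu.of_irreducible (irreducible_polyShift hp) hξ hη
    have hcop : ∀ (b : Polynomial C), (∀ ξ : Cbar C, aeval ξ b = 0 → ∃ i, ξ = D.β i) →
        ∀ j : ℤ, j ≠ k → IsCoprime (polyShift C j (p ^ m)) b := by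
      intro b hb j hj
      rw [polyShift_pow]
      refine IsCoprime.pow_left ?_
      rw [Polynomial.isCoprime_iff_aeval_ne_zero_of_isAlgClosed C (Cbar C)]
      intro ζ
      by_contra! h
      obtain ⟨h1, h2⟩ := h
      have h3 : IsRootOrBase D u (ζ + ((j - k : ℤ) : Cbar C)) := by
        apply hroot
        rw [aeval_polyShift] at h1 ⊢
        rw [← h1]
        congr 2
        push_cast
        ring
      have := hu ζ (j - k) (Or.inr (hb ζ h2)) h3
      omega
    rcases le_or_gt 0 k with h0 | h0
    · obtain ⟨n, rfl⟩ := Int.eq_ofNat_of_zero_le h0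
      obtain ⟨b, hb0, hb, hbS⟩ := exists_denominator_Smap hr hℓ D hW
      obtain ⟨N, hN⟩ := exists_reduces_left_iterate hb0 hbS hpm n
        fun j _ hj => hcop b hb j (by omega)
      refine ⟨_, mul_ne_zero (polyShift_ne_zero hpm) (pow_ne_zero N hb0), hu.mono fun η hη => ?_,
        hN⟩
      rw [map_mul, map_mul, mul_eq_zero, mul_eq_zero, polyShift_pow, map_pow, map_pow] at hη
      rcases hη with h | h | h
      · exact Or.inl h
      · exact hroot η (eq_zero_of_pow_eq_zero h)
      · exact Or.inr (hb η (eq_zero_of_pow_eq_zero h))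
    · obtain ⟨n, hn⟩ := Int.eq_ofNat_of_zero_le (show 0 ≤ -k by omega)
      obtain rfl : k = -n := by omega
      obtain ⟨b, hb0, hb, hbS⟩ := exists_denominator_Smap_symm hr hℓ D hW
      refine ⟨_, polyShift_ne_zero hpm, hu.mono fun η hη => ?_,
        reduces_right_iterate hbS hpm n fun j hj => hcop b hb (-j) (by omega)⟩
      rw [map_mul, mul_eq_zero, polyShift_pow, map_pow] at hη
      rcases hη with h | h
      · exact Or.inl h
      · exact hroot η (eq_zero_of_pow_eq_zero h)
  · push Not at hk
    have hno : ∀ (ξ : Cbar C) (k : ℤ), aeval ξ p = 0 → ¬ IsRootOrBase D u (ξ + k) := by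
      intro ξ k h
      refine hk (-k) _ ?_
      rw [aeval_polyShift, ← h]
      congr 2
      push_cast
      ring
    have hsplit : ∀ ξ : Cbar C, IsRootOrBase D (u * p ^ m) ξ →
        IsRootOrBase D u ξ ∨ aeval ξ p = 0 := by
      rintro ξ (h | h)
      · rw [map_mul, mul_eq_zero, map_pow] at h
        exact h.imp Or.inl eq_zero_of_pow_eq_zero
      · exact Or.inl (Or.inr h)
    refine ⟨p ^ m, hpm, fun ξ k h1 h2 => ?_, Reduces.refl _⟩
    rcases hsplit _ h1 with h1 | h1 <;> rcases hsplit _ h2 with h2 | h2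
    · exact hu ξ k h1 h2
    · exact absurd (by simpa using h1) (hno (ξ + k) (-k) h2)
    · exact absurd h2 (hno ξ k h1)
    · exact eq_zero_of_roots_of_irreducible hp h1 h2

theorem exists_reduces (hr : 1 ≤ r) (hℓ : ℓ 0 * ℓ r ≠ 0)
    (hW : IsSuitableBasis C ℓ r D W) (v : Polynomial C) (hv : v ≠ 0)
    {u : Polynomial C} (hu : RootsShiftFree D u) :
    ∃ u' : Polynomial C, u' ≠ 0 ∧ RootsShiftFree D (u * u') ∧ Reduces ℓ W v u' := by
  induction v using UniqueFactorizationMonoid.induction_on_coprime generalizing u with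
  | h0 => exact absurd rfl hv
  | @h1 x hx =>
    refine ⟨x, hv, hu.mono fun ξ h => Or.inl ?_, Reduces.refl _⟩
    rw [map_mul, mul_eq_zero] at h
    exact h.resolve_right (hx.map (aeval ξ)).ne_zero
  | @hpr p i hp => exact exists_reduces_of_irreducible hr hℓ hW hp.irreducible i hu
  | @hcp x y hxy hx hy =>
    obtain ⟨hx0, hy0⟩ := mul_ne_zero_iff.mp hv
    obtain ⟨x', hx0', hux, hxx⟩ := hx hx0 hu
    obtain ⟨y', hy0', huy, hyy⟩ := hy hy0 hux
    exact ⟨x' * y', mul_ne_zero hx0' hy0', by rwa [← mul_assoc],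
      Reduces.mul hxy.isCoprime hx0 hy0 hx0' hy0' hxx hyy⟩

theorem RootsShiftFree.shiftFree {u : Polynomial C} (hu : RootsShiftFree D u) :
    ShiftFree (u.map (algebraMap C (Cbar C)) * ∏ i, (X - Polynomial.C (D.β i))) := by
  have hroot : ∀ ξ : Cbar C,
      eval ξ (u.map (algebraMap C (Cbar C)) * ∏ i, (X - Polynomial.C (D.β i))) = 0 →
        IsRootOrBase D u ξ := by
    intro ξ h
    rw [eval_mul, mul_eq_zero, eval_map_algebraMap, eval_prod, Finset.prod_eq_zero_iff] at h
    refine h.imp_right ?_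
    rintro ⟨i, -, hi⟩
    exact ⟨i, by simpa [sub_eq_zero] using hi⟩
  intro k hk
  rw [Polynomial.isCoprime_iff_aeval_ne_zero_of_isAlgClosed (Cbar C) (Cbar C)]
  intro ξ
  by_contra! h
  simp only [Polynomial.coe_aeval_eq_eval, eval_comp, eval_add, eval_X, eval_C] at h
  exact hk (hu ξ k (hroot _ h.1) (hroot _ h.2))

theorem exists_polynomial_coordinates (hW : IsVSBasis C r W) (f : Fin r → RatFunc C) :
    ∃ (v : Polynomial C) (c : Fin r → Polynomial C), v ≠ 0 ∧
      f = (toRat C v)⁻¹ • ∑ i, toRat C (c i) • W i := by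
  obtain ⟨a, rfl⟩ := (Submodule.mem_span_range_iff_exists_fun (RatFunc C)).mp
    (hW.2 ▸ Submodule.mem_top : f ∈ Submodule.span (RatFunc C) (Set.range W))
  obtain ⟨v, hv⟩ := IsLocalization.exist_integer_multiples_of_finite
    (nonZeroDivisors (Polynomial C)) a
  choose c hc using hv
  have hv0 : (v : Polynomial C) ≠ 0 := nonZeroDivisors.ne_zero v.2
  have hv0' : toRat C v ≠ 0 := by simp
  refine ⟨v, c, hv0, ?_⟩
  rw [Finset.smul_sum]
  refine Finset.sum_congr rfl fun i _ => ?_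
  have hi : toRat C (c i) = toRat C v * a i := (hc i).trans (Algebra.smul_def _ _)
  rw [smul_smul, hi, inv_mul_cancel_left₀ hv0']

end ShiftFreeDenominators

theorem statement13 [NeZero r] (hr : 1 ≤ r) (hℓ : ℓ 0 * ℓ r ≠ 0) {I : ℕ}
    (D : SuitableData C ℓ r I) (W : Fin r → (Fin r → RatFunc C))
    (hW : IsSuitableBasis C ℓ r D W) (f : Fin r → RatFunc C) :
    ∃ (g : Fin r → RatFunc C) (c : Fin r → Polynomial C) (u : Polynomial C),
      u ≠ 0 ∧
      f = Dmap C ℓ r g + (toRat C u)⁻¹ • ∑ i, toRat C (c i) • W i ∧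
      ShiftFree (u.map (algebraMap C (Cbar C)) * ∏ i, (X - Polynomial.C (D.β i))) := by
  obtain ⟨v, d, hv, rfl⟩ := exists_polynomial_coordinates hW.1 f
  obtain ⟨u, hu0, hu, hred⟩ := exists_reduces hr hℓ hW v hv rootsShiftFree_one
  rw [one_mul] at hu
  obtain ⟨g, c, hgc⟩ := hred d
  exact ⟨g, c, u, hu0, hgc, hu.shiftFree⟩

end PRec
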